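/- arXiv:1310.8605 — 2 statements merged into one kernel-verified Lean document; each statement's English description precedes it below -/
import Mathlib

section
/- Let W be a finitely generated infinite irreducible Coxeter group. Then W has no nontrivial finite normal subgroup: every normal subgroup N ⊴ W with N finite satisfies N = {1}. -/
/-- A Coxeter matrix `M` on the index set `B` is irreducible if `B` cannot be
partitioned into two nonempty subsets `A` and `Aᶜ` with `M a b = 2` for all
`a ∈ A`, `b ∈ Aᶜ`. -/
def CoxeterIrreducible {B : Type*} (M : CoxeterMatrix B) : Prop :=
  ¬ ∃ A : Set B, A.Nonempty ∧ Aᶜ.Nonempty ∧ ∀ a ∈ A, ∀ b ∈ Aᶜ, M a b = 2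

namespace CoxeterMatrix

open Real Module

variable {B : Type*} (M : CoxeterMatrix B)

/-- Twice the `i`-th row of the canonical bilinear form of a Coxeter matrix. An entry `0` of `M`
stands for `∞` and gives the value `-2`, since `cos (π / 0) = 1`. -/
noncomputable def canonicalRow (i : B) : B → ℝ := fun j ↦ -2 * cos (π / M i j)

theorem canonicalRow_self (i : B) : M.canonicalRow i i = 2 := by
  simp [canonicalRow]

theorem canonicalRow_comm (i j : B) : M.canonicalRow i j = M.canonicalRow j i := by
  simp [canonicalRow, M.symmetric i j]

theorem canonicalRow_eq_zero {i j : B} (h : M i j = 2) : M.canonicalRow i j = 0 := by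
  simp [canonicalRow, h]

theorem canonicalRow_ne_zero {i j : B} (hij : i ≠ j) (h : M i j ≠ 2) :
    M.canonicalRow i j ≠ 0 := by
  have h1 : M i j ≠ 1 := M.off_diagonal i j hij
  rcases Nat.eq_zero_or_pos (M i j) with h0 | h0
  · simp [canonicalRow, h0]
  · have h3 : (3 : ℝ) ≤ M i j := by exact_mod_cast (by lia : 3 ≤ M i j)
    have hpos : 0 < cos (π / M i j) := by
      apply cos_pos_of_mem_Ioo
      constructor
      · have : 0 < π / M i j := by positivity
        linarith [pi_pos]
      · rw [div_lt_div_iff₀ (by linarith) two_pos]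
        nlinarith [pi_pos]
    simp only [canonicalRow]
    linarith

/-- The simple reflections of the contragredient of the canonical representation of a Coxeter
group. -/
noncomputable def canonicalReflection (i : B) : (B → ℝ) ≃ₗ[ℝ] (B → ℝ) :=
  reflection (f := LinearMap.proj i) (x := M.canonicalRow i)
    ((LinearMap.proj_apply i _).trans (M.canonicalRow_self i))

theorem canonicalReflection_apply (i : B) (v : B → ℝ) :
    M.canonicalReflection i v = v - v i • M.canonicalRow i := by
  rw [canonicalReflection, reflection_apply, LinearMap.proj_apply]

open Polynomial.Chebyshev in
/-- Two reflections whose product is a rotation of angle `2π / m` satisfy the braid relation. -/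
theorem _root_.Module.reflection_mul_reflection_pow_eq_one {V : Type*} [AddCommGroup V]
    [Module ℝ V] {x y : V} {f g : Dual ℝ V} (hf : f x = 2) (hg : g y = 2) {m : ℕ} (hm : 3 ≤ m)
    (h : f y * g x = 4 * cos (π / m) ^ 2) :
    (reflection hf * reflection hg) ^ m = 1 := by
  have hm0 : (m : ℝ) ≠ 0 := by positivity
  obtain ⟨θ, hθ⟩ : ∃ θ, θ = 2 * (π / m) := ⟨_, rfl⟩
  have hmθ : m * θ = 2 * π := by rw [hθ]; field_simp
  have ht : 2 * cos θ = f y * g x - 2 := by rw [h, hθ, cos_two_mul]; ring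
  have hsin : sin θ ≠ 0 := by
    have h3 : (3 : ℝ) ≤ m := by exact_mod_cast hm
    refine (sin_pos_of_pos_of_lt_pi (by rw [hθ]; positivity) ?_).ne'
    nlinarith [pi_pos, hmθ]
  apply LinearEquiv.toLinearMap_injective
  rw [reflection_mul_reflection_pow hf hg m _ ht]
  rcases Nat.even_or_odd' m with ⟨k, hk | hk⟩
  · have hS : (S ℝ ((k : ℤ) - 1)).eval (2 * cos θ) = 0 := by
      have := S_two_mul_real_cos θ ((k : ℤ) - 1)
      rw [show ((((k : ℤ) - 1 : ℤ) : ℝ) + 1) * θ = π by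
        have : (2 * k : ℝ) * θ = 2 * π := by rw [← hmθ, hk]; push_cast; ring
        push_cast; linarith, sin_pi] at this
      exact (mul_eq_zero.mp this).resolve_right hsin
    rw [show ((m : ℤ) - 2) / 2 = k - 1 by lia, show ((m : ℤ) - 1) / 2 = k - 1 by lia, hS]
    simp
  · have hS : (S ℝ (k : ℤ)).eval (2 * cos θ) + (S ℝ ((k : ℤ) - 1)).eval (2 * cos θ) = 0 := by
      have h1 := S_two_mul_real_cos θ (k : ℤ)
      have h2 := S_two_mul_real_cos θ ((k : ℤ) - 1)
      have hkθ : (k + 1) * θ = 2 * π - k * θ := by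
        rw [← hmθ, hk]; push_cast; ring
      push_cast at h1 h2
      rw [hkθ, sin_two_pi_sub] at h1
      rw [sub_add_cancel] at h2
      refine (mul_eq_zero.mp (?_ : _ * sin θ = 0)).resolve_right hsin
      rw [add_mul, h1, h2, neg_add_cancel]
    rw [show ((m : ℤ) - 2) / 2 = k - 1 by lia, show ((m : ℤ) - 1) / 2 = k by lia,
      show ((m : ℤ) - 3) / 2 = k - 1 by lia, show (m : ℤ) / 2 = k by lia, hS]
    simp

theorem isLiftable_canonicalReflection : M.IsLiftable M.canonicalReflection := by
  intro i j
  by_cases hij : i = j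
  · subst hij
    rw [M.diagonal, pow_one]
    exact LinearEquiv.ext fun v ↦ involutive_reflection _ v
  by_cases h2 : M i j = 2
  · have h2' : M j i = 2 := by rw [M.symmetric, h2]
    rw [h2]
    ext v k
    simp [pow_two, canonicalReflection_apply, M.canonicalRow_eq_zero h2,
      M.canonicalRow_eq_zero h2', M.canonicalRow_self]
    ring
  rcases Nat.eq_zero_or_pos (M i j) with h0 | h0
  · rw [h0, pow_zero]
  have h1 : M i j ≠ 1 := M.off_diagonal i j hij
  refine reflection_mul_reflection_pow_eq_one _ _ (by lia) ?_
  simp only [LinearMap.proj_apply, canonicalRow, M.symmetric j i]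
  ring

end CoxeterMatrix

namespace CoxeterSystem

variable {B W : Type*} [Group W] {M : CoxeterMatrix B} (cs : CoxeterSystem M W)

theorem simple_mul_simple_ne {i j : B} (hij : i ≠ j) (h : M i j ≠ 2) :
    cs.simple i * cs.simple j ≠ cs.simple j * cs.simple i := by
  classical
  intro hc
  have hc' := congrArg (cs.lift ⟨_, M.isLiftable_canonicalReflection⟩) hc
  simp only [map_mul, lift_apply_simple] at hc'
  have hv := congrFun (LinearEquiv.congr_fun hc' (Pi.single j 1)) i
  simp [CoxeterMatrix.canonicalReflection_apply, hij, M.canonicalRow_self] at hv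
  exact M.canonicalRow_ne_zero hij h (M.canonicalRow_comm i j ▸ by linarith)

/-! ### The inversion cocycle -/

open Classical in
/-- The action of a simple reflection on signed elements of `W`: it conjugates the element, and
flips the sign of the reflection itself. -/
noncomputable def signedConj (i : B) : Function.End (W × ZMod 2) :=
  fun p ↦ (cs.simple i * p.1 * cs.simple i, p.2 + if p.1 = cs.simple i then 1 else 0)

open Classical in
theorem signedConj_mul_pow_apply (i j : B) (k : ℕ) (x : W) (e : ZMod 2) :
    ((cs.signedConj i * cs.signedConj j) ^ k) (x, e) =
      ((cs.simple i * cs.simple j) ^ k * x * ((cs.simple i * cs.simple j) ^ k)⁻¹,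
        e + ∑ p ∈ Finset.range (2 * k),
          if x = cs.simple j * (cs.simple i * cs.simple j) ^ p then 1 else 0) := by
  obtain ⟨c, hc⟩ : ∃ c, c = cs.simple i * cs.simple j := ⟨_, rfl⟩
  have hflip (l : ℕ) : (c ^ l)⁻¹ * cs.simple j = cs.simple j * c ^ l := by
    have : SemiconjBy (cs.simple j) c c⁻¹ := by simp [SemiconjBy, hc, mul_assoc]
    simpa using (this.pow_right l).eq.symm
  have hconj (u v : W) : u * x * u⁻¹ = v ↔ x = u⁻¹ * v * u := by
    rw [mul_inv_eq_iff_eq_mul, mul_assoc, eq_inv_mul_iff_mul_eq]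
  rw [← hc]
  induction k with
  | zero => simp; rfl
  | succ k ih =>
    rw [pow_succ']
    change cs.signedConj i (cs.signedConj j (((cs.signedConj i * cs.signedConj j) ^ k) (x, e))) = _
    rw [ih]
    have e1 : c ^ k * x * (c ^ k)⁻¹ = cs.simple j ↔ x = cs.simple j * c ^ (2 * k) := by
      rw [hconj, hflip, two_mul, pow_add, mul_assoc]
    have e2 : cs.simple j * (c ^ k * x * (c ^ k)⁻¹) * cs.simple j = cs.simple i ↔
        x = cs.simple j * c ^ (2 * k + 1) := by
      rw [← eq_mul_inv_iff_mul_eq, ← eq_inv_mul_iff_mul_eq, inv_simple, ← hc, hconj, ← mul_assoc,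
        hflip, mul_assoc, mul_assoc, ← pow_succ', ← pow_add]
      congr! 3
      ring
    rw [show 2 * (k + 1) = 2 * k + 1 + 1 by ring, Finset.sum_range_succ, Finset.sum_range_succ]
    simp only [signedConj, e1, e2]
    refine Prod.ext ?_ ?_
    · simp [pow_succ', hc, mul_assoc]
    · simp only [add_assoc]

theorem isLiftable_signedConj : M.IsLiftable cs.signedConj := by
  classical
  intro i j
  refine funext fun ⟨x, e⟩ ↦ ?_
  rw [signedConj_mul_pow_apply, two_mul, Finset.sum_range_add]
  simp [pow_add, CharTwo.add_self_eq_zero]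
  rfl

/-- The parity of the number of times `x` occurs in the right inversion sequence of a word for
`w`. -/
noncomputable def inversionParity (w x : W) : ZMod 2 :=
  (cs.lift ⟨_, cs.isLiftable_signedConj⟩ w (x, 0)).2

theorem lift_signedConj_apply (w x : W) (e : ZMod 2) :
    cs.lift ⟨_, cs.isLiftable_signedConj⟩ w (x, e) =
      (w * x * w⁻¹, e + cs.inversionParity w x) := by
  unfold inversionParity
  induction w using cs.simple_induction_left generalizing x e with
  | one =>
    rw [map_one, one_mul, inv_one, mul_one]
    exact Prod.ext rfl (add_zero e).symm
  | mul_simple_left w i ih =>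
    rw [map_mul, lift_apply_simple]
    change cs.signedConj i _ = (_, _ + (cs.signedConj i _).2)
    rw [ih x e, ih x 0]
    simp [signedConj, mul_assoc, add_assoc]

theorem inversionParity_mul (u v x : W) :
    cs.inversionParity (u * v) x =
      cs.inversionParity v x + cs.inversionParity u (v * x * v⁻¹) := by
  have h : cs.inversionParity (u * v) x = (cs.lift ⟨_, cs.isLiftable_signedConj⟩ u
      (cs.lift ⟨_, cs.isLiftable_signedConj⟩ v (x, 0))).2 := by
    rw [inversionParity, map_mul]; rfl
  rw [h, lift_signedConj_apply, lift_signedConj_apply, zero_add]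

@[simp]
theorem inversionParity_one (x : W) : cs.inversionParity 1 x = 0 := by
  simpa using cs.inversionParity_mul 1 1 x

open Classical in
theorem inversionParity_simple (i : B) (x : W) :
    cs.inversionParity (cs.simple i) x = if x = cs.simple i then 1 else 0 := by
  simp [inversionParity, signedConj]

theorem inversionParity_inv (w x : W) :
    cs.inversionParity w⁻¹ (w * x * w⁻¹) = cs.inversionParity w x := by
  have h := cs.inversionParity_mul w⁻¹ w x
  rw [inv_mul_cancel, inversionParity_one] at h
  exact (CharTwo.add_eq_zero.mp h.symm).symm

theorem inversionParity_conj (w n x : W) :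
    cs.inversionParity (w * n * w⁻¹) (w * x * w⁻¹) =
      cs.inversionParity w x + cs.inversionParity n x +
        cs.inversionParity w (n * x * n⁻¹) := by
  rw [inversionParity_mul, inversionParity_inv, inversionParity_mul]
  simp [mul_assoc, add_assoc]

theorem mem_rightInvSeq_of_inversionParity_ne_zero {ω : List B} {x : W}
    (h : cs.inversionParity (cs.wordProd ω) x ≠ 0) : x ∈ cs.rightInvSeq ω := by
  induction ω with
  | nil => simp at h
  | cons i ω ih =>
    rw [wordProd_cons, inversionParity_mul, inversionParity_simple] at h
    rw [rightInvSeq, List.mem_cons]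
    by_cases hx : cs.wordProd ω * x * (cs.wordProd ω)⁻¹ = cs.simple i
    · left
      rw [← hx]
      simp [mul_assoc]
    · right
      exact ih (by simpa [hx] using h)

theorem isRightInversion_of_inversionParity_ne_zero {w x : W}
    (h : cs.inversionParity w x ≠ 0) : cs.IsRightInversion w x := by
  obtain ⟨ω, hω, rfl⟩ := cs.exists_isReduced w
  exact cs.isRightInversion_of_mem_rightInvSeq hω
    (cs.mem_rightInvSeq_of_inversionParity_ne_zero h)

theorem finite_setOf_inversionParity_ne_zero (w : W) :
    {x | cs.inversionParity w x ≠ 0}.Finite := by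
  obtain ⟨ω, rfl⟩ := cs.wordProd_surjective w
  exact (cs.rightInvSeq ω).finite_toSet.subset
    fun _ ↦ cs.mem_rightInvSeq_of_inversionParity_ne_zero

theorem inversionParity_simple_ne_zero_of_isRightDescent {w : W} {i : B}
    (h : cs.IsRightDescent w i) : cs.inversionParity w (cs.simple i) ≠ 0 := by
  intro h0
  have h1 : cs.inversionParity (w * cs.simple i) (cs.simple i) ≠ 0 := by
    rw [inversionParity_mul, inversionParity_simple]
    simp [h0]
  have h2 := (cs.isRightInversion_of_inversionParity_ne_zero h1).2
  rw [simple_mul_simple_cancel_right] at h2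
  exact lt_asymm h h2

theorem eq_one_of_inversionParity_simple_eq_zero {w : W}
    (h : ∀ i, cs.inversionParity w (cs.simple i) = 0) : w = 1 := by
  by_contra hw
  obtain ⟨i, hi⟩ := cs.exists_rightDescent_of_ne_one hw
  exact cs.inversionParity_simple_ne_zero_of_isRightDescent hi (h i)

theorem inversionParity_injective : Function.Injective cs.inversionParity := by
  intro w w' h
  rw [← mul_inv_eq_one]
  refine cs.eq_one_of_inversionParity_simple_eq_zero fun i ↦ ?_
  have h1 := cs.inversionParity_inv w' (w'⁻¹ * cs.simple i * w')
  rw [inversionParity_mul, h, inv_inv,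
    show w' * (w'⁻¹ * cs.simple i * w') * w'⁻¹ = cs.simple i by group] at *
  rw [h1, CharTwo.add_self_eq_zero]

theorem finite_of_finite_isReflection (h : {t | cs.IsReflection t}.Finite) : Finite W := by
  have : Finite (Set.powerset {t | cs.IsReflection t}) := h.finite_subsets
  refine Finite.of_injective (fun w ↦ (⟨{x | cs.inversionParity w x ≠ 0},
    fun _ hx ↦ (cs.isRightInversion_of_inversionParity_ne_zero hx).1⟩ :
      Set.powerset {t | cs.IsReflection t})) fun w w' hw ↦ cs.inversionParity_injective ?_
  funext x
  have hx : cs.inversionParity w x ≠ 0 ↔ cs.inversionParity w' x ≠ 0 :=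
    Set.ext_iff.mp (congrArg Subtype.val hw) x
  generalize cs.inversionParity w x = p at hx
  generalize cs.inversionParity w' x = q at hx
  revert p q
  decide

/-! ### Reflections moved by a finite normal subgroup -/

/-- The elements whose sign is changed by some element of `N`. -/
def inversionsOf (N : Subgroup W) : Set W := {x | ∃ n ∈ N, cs.inversionParity n x ≠ 0}

theorem finite_inversionsOf (N : Subgroup W) [Finite N] : (cs.inversionsOf N).Finite := by
  refine (Set.finite_iUnion
    fun n : N ↦ cs.finite_setOf_inversionParity_ne_zero (n : W)).subset ?_
  rintro x ⟨n, hn, hx⟩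
  exact Set.mem_iUnion.mpr ⟨⟨n, hn⟩, hx⟩

variable {cs} in
theorem conj_mem_inversionsOf {N : Subgroup W} {m x : W} (hm : m ∈ N)
    (hx : x ∈ cs.inversionsOf N) : m * x * m⁻¹ ∈ cs.inversionsOf N := by
  obtain ⟨n, hn, hx⟩ := hx
  by_cases h : cs.inversionParity m x = 0
  · refine ⟨n * m⁻¹, N.mul_mem hn (N.inv_mem hm), ?_⟩
    rw [inversionParity_mul, inversionParity_inv, h]
    simpa [mul_assoc] using hx
  · exact ⟨m⁻¹, N.inv_mem hm, by rwa [inversionParity_inv]⟩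

variable {cs} in
theorem simple_conj_mem_inversionsOf {N : Subgroup W} [hN : N.Normal] {i : B} {x : W}
    (hx : x ∈ cs.inversionsOf N) (hxi : ∀ m ∈ N, m * cs.simple i * m⁻¹ ≠ x) :
    cs.simple i * x * (cs.simple i)⁻¹ ∈ cs.inversionsOf N := by
  obtain ⟨n, hn, hx⟩ := hx
  refine ⟨cs.simple i * n * (cs.simple i)⁻¹, hN.conj_mem n hn _, ?_⟩
  have h1 : x ≠ cs.simple i := fun h ↦ hxi 1 N.one_mem (by simp [h])
  have h2 : n * x * n⁻¹ ≠ cs.simple i := fun h ↦ hxi n⁻¹ (N.inv_mem hn) (by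
    rw [← h]; simp [mul_assoc])
  rw [inversionParity_conj, inversionParity_simple, inversionParity_simple, if_neg h1, if_neg h2]
  simpa using hx

theorem simple_conj_mem_inversionsOf_iff (N : Subgroup W) [hN : N.Normal] [Finite N] (i : B)
    (x : W) :
    cs.simple i * x * cs.simple i ∈ cs.inversionsOf N ↔ x ∈ cs.inversionsOf N := by
  obtain ⟨I, hI⟩ : ∃ I, I = cs.inversionsOf N := ⟨_, rfl⟩
  have hfin : I.Finite := hI ▸ cs.finite_inversionsOf N
  obtain ⟨J, hJ⟩ : ∃ J : Set W, J = {x | cs.simple i * x * cs.simple i ∈ I} := ⟨_, rfl⟩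
  have hJI : J = (fun x ↦ cs.simple i * x * cs.simple i) '' I := by
    ext y
    refine ⟨fun hy ↦ ⟨_, hJ ▸ hy, by simp [mul_assoc]⟩, ?_⟩
    rintro ⟨z, hz, rfl⟩
    simpa [hJ, mul_assoc] using hz
  have hcard : J.ncard = I.ncard := by
    rw [hJI]
    exact Set.ncard_image_of_injective _ fun u v huv ↦ by simpa using huv
  have hJfin : J.Finite := hJI ▸ hfin.image _
  have hIconj : ∀ m ∈ N, ∀ y ∈ I, m * y * m⁻¹ ∈ I := fun m hm y hy ↦ by
    rw [hI] at hy ⊢; exact conj_mem_inversionsOf hm hy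
  have hJconj : ∀ m ∈ N, ∀ y ∈ J, m * y * m⁻¹ ∈ J := fun m hm y hy ↦ by
    rw [hJ] at hy ⊢
    have := hIconj _ (hN.conj_mem m hm (cs.simple i)) _ hy
    simpa [mul_assoc] using this
  have hoff : ∀ y, (∀ m ∈ N, m * cs.simple i * m⁻¹ ≠ y) → (y ∈ I ↔ y ∈ J) := by
    intro y hy
    rw [hJ, hI]
    constructor
    · intro h
      simpa using simple_conj_mem_inversionsOf h hy
    · intro h
      have := simple_conj_mem_inversionsOf (i := i) h fun m hm hmy ↦
        hy _ (hN.conj_mem m hm (cs.simple i)) (by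
          have := congrArg (fun w ↦ cs.simple i * w * cs.simple i) hmy
          simpa [mul_assoc] using this)
      simpa [mul_assoc] using this
  have hsub : ∀ K L : Set W, (∀ m ∈ N, ∀ y ∈ K, m * y * m⁻¹ ∈ K) →
      (∀ m ∈ N, ∀ y ∈ L, m * y * m⁻¹ ∈ L) →
      (∀ y, (∀ m ∈ N, m * cs.simple i * m⁻¹ ≠ y) → (y ∈ K ↔ y ∈ L)) →
      (cs.simple i ∈ K → cs.simple i ∈ L) → K ⊆ L := by
    intro K L hK hL hKL hi y hy
    by_cases h : ∀ m ∈ N, m * cs.simple i * m⁻¹ ≠ y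
    · exact (hKL y h).mp hy
    · push Not at h
      obtain ⟨m, hm, rfl⟩ := h
      refine hL m hm _ (hi ?_)
      simpa [mul_assoc] using hK m⁻¹ (N.inv_mem hm) _ hy
  have hIJ : I = J := by
    by_cases h : cs.simple i ∈ J
    · exact Set.eq_of_subset_of_ncard_le (hsub I J hIconj hJconj hoff fun _ ↦ h) hcard.le hJfin
    · exact (Set.eq_of_subset_of_ncard_le
        (hsub J I hJconj hIconj (fun y hy ↦ (hoff y hy).symm) fun h' ↦ absurd h' h)
        hcard.ge hfin).symm
  have := Set.ext_iff.mp hIJ x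
  rw [← hI, this, hJ]
  rfl

theorem conj_mem_inversionsOf_iff (N : Subgroup W) [N.Normal] [Finite N] (w x : W) :
    w * x * w⁻¹ ∈ cs.inversionsOf N ↔ x ∈ cs.inversionsOf N := by
  induction w using cs.simple_induction_left with
  | one => simp
  | mul_simple_left w i ih =>
    rw [← ih, ← cs.simple_conj_mem_inversionsOf_iff N i (w * x * w⁻¹)]
    simp [mul_assoc]

theorem conj_simple_eq_of_notMem_inversionsOf {N : Subgroup W} [hN : N.Normal] [Finite N] {i : B}
    (hi : cs.simple i ∉ cs.inversionsOf N) {n : W} (hn : n ∈ N) :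
    n * cs.simple i * n⁻¹ = cs.simple i := by
  by_contra h
  have hp : cs.inversionParity n (cs.simple i) = 0 := by
    by_contra h0
    exact hi ⟨n, hn, h0⟩
  refine hi ((cs.conj_mem_inversionsOf_iff N (cs.simple i) _).mp
    ⟨cs.simple i * n * (cs.simple i)⁻¹, hN.conj_mem n hn _, ?_⟩)
  rw [inversionParity_conj, hp, inversionParity_simple, inversionParity_simple, if_neg h]
  simp

/-! ### Dihedral parabolic subgroups -/

/-- A minimal-length element of a coset of a rank two parabolic subgroup has no inversion there, so
the inversions in that subgroup are those of the parabolic component. -/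
theorem exists_wordProd_inversionParity_eq (n : W) (a b : B) :
    ∃ ω : List B, (∀ i ∈ ω, i = a ∨ i = b) ∧ ∀ τ : List B, (∀ i ∈ τ, i = a ∨ i = b) →
      cs.inversionParity n (cs.wordProd τ) =
        cs.inversionParity (cs.wordProd ω) (cs.wordProd τ) := by
  obtain ⟨ω, hω, hmin⟩ := exists_minimalFor_of_wellFoundedLT
    (fun ω : List B ↦ ∀ i ∈ ω, i = a ∨ i = b) (fun ω ↦ cs.length (n * cs.wordProd ω))
    ⟨[], by simp⟩
  refine ⟨ω.reverse, by simpa using hω, fun τ hτ ↦ ?_⟩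
  have hn : n = (n * cs.wordProd ω) * cs.wordProd ω.reverse := by simp
  conv_lhs => rw [hn, inversionParity_mul]
  rw [add_eq_left]
  by_contra h
  have hlt := (cs.isRightInversion_of_inversionParity_ne_zero h).2
  have heq : n * cs.wordProd ω * (cs.wordProd ω.reverse * cs.wordProd τ *
      (cs.wordProd ω.reverse)⁻¹) = n * cs.wordProd (τ ++ ω) := by
    simp [wordProd_append, mul_assoc]
  rw [heq] at hlt
  exact hlt.not_ge (hmin (fun i hi ↦ (List.mem_append.mp hi).elim (hτ i) (hω i)) hlt.le)

theorem inversionParity_wordProd_concat_ne_zero {ω : List B} {i : B}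
    (h : ∀ τ, τ.Sublist (ω ++ [i]) → cs.wordProd τ = cs.wordProd (ω ++ [i]) →
      (ω ++ [i]).length ≤ τ.length) :
    cs.inversionParity (cs.wordProd (ω ++ [i])) (cs.simple i) ≠ 0 := by
  intro h0
  rw [wordProd_append, wordProd_singleton, inversionParity_mul, inversionParity_simple] at h0
  have h1 : cs.inversionParity (cs.wordProd ω) (cs.simple i) ≠ 0 := by
    intro h2
    simp [h2] at h0
  obtain ⟨j, hj, hji⟩ := List.mem_iff_getElem.mp (cs.mem_rightInvSeq_of_inversionParity_ne_zero h1)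
  have hprod := cs.wordProd_mul_getD_rightInvSeq ω j
  rw [List.getD_eq_getElem _ 1 hj, hji] at hprod
  have hlen := h (ω.eraseIdx j) (ω.eraseIdx_sublist j |>.trans (List.sublist_append_left _ _))
    (by rw [← hprod, wordProd_append, wordProd_singleton])
  have := (ω.eraseIdx_sublist j).length_le
  simp at hlen
  lia

/-- An element of a rank two parabolic subgroup with `s_b` but neither `s_a` nor `s_b s_a s_b` as
inversions is `s_b` itself. -/
theorem wordProd_eq_simple_of_inversionParity {a b : B} {ω : List B}
    (hω : ∀ i ∈ ω, i = a ∨ i = b)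
    (hab : cs.simple a ≠ cs.simple b)
    (ha : cs.inversionParity (cs.wordProd ω) (cs.simple a) = 0)
    (hb : cs.inversionParity (cs.wordProd ω) (cs.simple b) ≠ 0)
    (hbab : cs.inversionParity (cs.wordProd ω)
      (cs.simple b * cs.simple a * cs.simple b) = 0) :
    cs.wordProd ω = cs.simple b := by
  obtain ⟨σ, ⟨hσω, hσ⟩, hmin⟩ := exists_minimalFor_of_wellFoundedLT
    (fun σ : List B ↦ σ.Sublist ω ∧ cs.wordProd σ = cs.wordProd ω) List.length
    ⟨ω, List.Sublist.refl ω, rfl⟩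
  replace hmin : ∀ τ, τ.Sublist σ → cs.wordProd τ = cs.wordProd σ → σ.length ≤ τ.length :=
    fun τ hτ hτσ ↦ (le_total _ _).elim id (hmin ⟨hτ.trans hσω, hτσ.trans hσ⟩)
  replace hω : ∀ i ∈ σ, i = a ∨ i = b := fun i hi ↦ hω i (hσω.mem hi)
  rw [← hσ] at ha hb hbab ⊢
  rcases σ.eq_nil_or_concat' with rfl | ⟨σ, i, rfl⟩
  · simp at hb
  have hi := cs.inversionParity_wordProd_concat_ne_zero hmin
  obtain rfl | rfl := hω i (by simp)
  · exact absurd ha hi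
  have hia : cs.inversionParity (cs.wordProd σ) (cs.simple a) = 0 := by
    rw [wordProd_append, wordProd_singleton, inversionParity_mul, inversionParity_simple,
      if_neg] at hbab
    · simpa [mul_assoc] using hbab
    · intro h
      rw [mul_eq_right, mul_eq_one_iff_eq_inv, inv_simple] at h
      exact hab h.symm
  rcases σ.eq_nil_or_concat' with rfl | ⟨σ, j, rfl⟩
  · simp
  have hj := cs.inversionParity_wordProd_concat_ne_zero (ω := σ) (i := j) fun τ hτ hτσ ↦ by
    have := hmin (τ ++ [i]) (hτ.append_right _) (by rw [wordProd_append, hτσ, ← wordProd_append])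
    simpa using this
  obtain rfl | rfl := hω j (by simp)
  · exact absurd hia hj
  have := hmin σ (by simp) (by simp [wordProd_append, wordProd_cons])
  simp at this

theorem eq_two_of_notMem_inversionsOf_of_mem {N : Subgroup W} [hN : N.Normal] [Finite N] {a b : B}
    (ha : cs.simple a ∉ cs.inversionsOf N) (hb : cs.simple b ∈ cs.inversionsOf N) :
    M a b = 2 := by
  by_contra h2
  have hne : a ≠ b := by rintro rfl; exact ha hb
  have hsne : cs.simple a ≠ cs.simple b := fun h ↦ ha (h ▸ hb)
  have hcomm := cs.simple_mul_simple_ne hne h2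
  have hzero : ∀ w, ∀ n ∈ N, cs.inversionParity n (w * cs.simple a * w⁻¹) = 0 := by
    intro w n hn
    by_contra h
    exact ha ((cs.conj_mem_inversionsOf_iff N w _).mp ⟨n, hn, h⟩)
  obtain ⟨n, hn, hnb⟩ := hb
  have hna := cs.conj_simple_eq_of_notMem_inversionsOf ha hn
  have haba : cs.inversionParity n (cs.simple a * cs.simple b * cs.simple a) ≠ 0 := by
    have h := cs.inversionParity_conj (cs.simple a) n (cs.simple b)
    have h1 : n * cs.simple b * n⁻¹ ≠ cs.simple a := by
      rw [← hna]
      intro h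
      exact hsne (by simpa using h.symm)
    have h2 : cs.simple a * n * (cs.simple a)⁻¹ = n := by
      rw [mul_inv_eq_iff_eq_mul, ← mul_inv_eq_iff_eq_mul.mp hna]
    rw [h2, inversionParity_simple, inversionParity_simple, if_neg hsne.symm, if_neg h1,
      inv_simple] at h
    simpa [h] using hnb
  obtain ⟨ω, hω, hτ⟩ := cs.exists_wordProd_inversionParity_eq n a b
  have hτa := hτ [a] (by simp)
  have hτb := hτ [b] (by simp)
  have hτbab := hτ [b, a, b] (by simp)
  have hτaba := hτ [a, b, a] (by simp)
  simp only [wordProd_cons, wordProd_nil, mul_one, ← mul_assoc] at hτa hτb hτbab hτaba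
  have hd := cs.wordProd_eq_simple_of_inversionParity hω hsne
    (by rw [← hτa]; simpa using hzero 1 n hn) (by rwa [← hτb])
    (by rw [← hτbab]; simpa using hzero (cs.simple b) n hn)
  rw [hτaba, hd, inversionParity_simple] at haba
  refine haba (if_neg fun h ↦ hcomm ?_)
  rw [← eq_mul_inv_iff_mul_eq, inv_simple] at h
  exact h

end CoxeterSystem

/-- A finitely generated infinite irreducible Coxeter group has no nontrivial
finite normal subgroup. -/
theorem coxeter_no_finite_normal_subgroup
    {B : Type*} [Finite B] (M : CoxeterMatrix B)
    (W : Type*) [Group W] (cs : CoxeterSystem M W) [Infinite W]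
    (hirr : CoxeterIrreducible M)
    (N : Subgroup W) (hnorm : N.Normal) (hfin : Finite N) :
    N = ⊥ := by
  by_cases hA : ∀ i, cs.simple i ∉ cs.inversionsOf N
  · rw [Subgroup.eq_bot_iff_forall]
    refine fun n hn ↦ cs.eq_one_of_inversionParity_simple_eq_zero fun i ↦ ?_
    by_contra h
    exact hA i ⟨n, hn, h⟩
  by_cases hB : ∀ i, cs.simple i ∈ cs.inversionsOf N
  · refine (not_finite_iff_infinite.mpr ‹Infinite W› ?_).elim
    refine cs.finite_of_finite_isReflection ((cs.finite_inversionsOf N).subset ?_)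
    rintro _ ⟨w, i, rfl⟩
    exact (cs.conj_mem_inversionsOf_iff N w _).mpr (hB i)
  push Not at hA hB
  exact (hirr ⟨{i | cs.simple i ∉ cs.inversionsOf N}, hB,
    hA.imp fun _ hi ↦ by simpa using hi,
    fun a ha b hb ↦ cs.eq_two_of_notMem_inversionsOf_of_mem ha (by simpa using hb)⟩).elim
end

section
/- Let Γ be a simple graph, A = A(Γ) the associated right-angled Artin group, H a subgroup of A, and N a normal subgroup of H. If there is no injective group homomorphism from the free group of rank 2 (FreeGroup (Fin 2)) into N, then N is contained in the center of H. -/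
/-- The set of defining relators of the right-angled Artin group on `Γ`. -/
abbrev raagRels {V : Type*} (Γ : SimpleGraph V) : Set (FreeGroup V) :=
  {r | ∃ u v : V, Γ.Adj u v ∧
    r = FreeGroup.of u * FreeGroup.of v * (FreeGroup.of u)⁻¹ * (FreeGroup.of v)⁻¹}

/-- The right-angled Artin group associated to a simple graph `Γ`. -/
abbrev RAAG {V : Type*} (Γ : SimpleGraph V) := PresentedGroup (raagRels Γ)

/-- The free group of rank two does not embed in the group. -/
def HasNoFreeSubgroup (G : Type*) [Group G] : Prop :=
  ¬ ∃ f : FreeGroup (Fin 2) →* G, Function.Injective f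

theorem HasNoFreeSubgroup.of_injective {G K : Type*} [Group G] [Group K]
    (hK : HasNoFreeSubgroup K) (f : G →* K) (hf : Function.Injective f) :
    HasNoFreeSubgroup G :=
  fun ⟨e, he⟩ => hK ⟨f.comp e, hf.comp he⟩

theorem HasNoFreeSubgroup.of_surjective {G K : Type*} [Group G] [Group K]
    (hG : HasNoFreeSubgroup G) (f : G →* K) (hf : Function.Surjective f) :
    HasNoFreeSubgroup K := by
  rintro ⟨e, he⟩
  choose s hs using hf
  refine hG ⟨FreeGroup.lift fun i => s (e (FreeGroup.of i)), ?_⟩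
  have hcomp : f.comp (FreeGroup.lift fun i => s (e (FreeGroup.of i))) = e := by
    ext i
    simp [hs]
  exact Function.Injective.of_comp (f := f) (by rwa [← MonoidHom.coe_comp, hcomp])

namespace FreeGroup

variable {X : Type*}

theorem eq_one_of_forall_commute [Nontrivial X] {z : FreeGroup X}
    (hz : ∀ x, Commute (of x) z) : z = 1 := by
  classical
  by_contra hne
  have hw : z.toWord ≠ [] := by simpa using hne
  obtain ⟨y, hy⟩ := exists_ne (z.toWord.getLast hw).1
  have hright : IsReduced (z.toWord ++ [(y, true)]) := by
    refine List.isChain_append.2 ⟨isReduced_toWord, List.isChain_singleton _, ?_⟩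
    intro a ha b hb hab
    rw [List.getLast?_eq_getLast_of_ne_nil hw] at ha
    simp only [Option.mem_def, Option.some.injEq, List.head?_cons] at ha hb
    subst ha hb
    exact absurd hab.symm hy
  have hcomm : reduce ((y, true) :: z.toWord) = z.toWord ++ [(y, true)] := by
    have h := congrArg toWord (hz y).eq
    rw [toWord_mul, toWord_mul, toWord_of, hright.reduce_eq] at h
    exact h
  rw [reduce.cons, reduce_toWord] at hcomm
  rcases hz' : z.toWord with _ | ⟨a, l⟩
  · exact hw hz'
  · simp only [hz'] at hcomm hy
    split_ifs at hcomm
    · have := congrArg List.length hcomm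
      simp at this
      omega
    · have h : ((y, true) :: a :: l).getLast (by simp) = (a :: l ++ [(y, true)]).getLast (by simp) :=
        List.getLast_congr _ _ hcomm
      rw [List.getLast_cons (by simp), List.getLast_append_singleton] at h
      exact hy (by rw [h])

theorem isCyclic_of_subsingleton [Subsingleton X] : IsCyclic (FreeGroup X) := by
  rcases isEmpty_or_nonempty X with h | ⟨⟨x⟩⟩
  · infer_instance
  · have := uniqueOfSubsingleton x
    infer_instance

theorem isCyclic_of_hasNoFreeSubgroup {M : Subgroup (FreeGroup X)} (hM : HasNoFreeSubgroup M) :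
    IsCyclic M := by
  have e := IsFreeGroup.toFreeGroup M
  have : Subsingleton (IsFreeGroup.Generators M) := by
    by_contra h
    rw [not_subsingleton_iff_nontrivial] at h
    obtain ⟨a, b, hab⟩ := h
    refine hM ⟨e.symm.toMonoidHom.comp (map ![a, b]), e.symm.injective.comp (map_injective ?_)⟩
    intro i j
    fin_cases i <;> fin_cases j <;> simp [hab, hab.symm]
  exact e.isCyclic.2 isCyclic_of_subsingleton

theorem isCyclic_centralizer {z : FreeGroup X} (hz : z ≠ 1) :
    IsCyclic (Subgroup.centralizer {z}) := by
  have e := IsFreeGroup.toFreeGroup (Subgroup.centralizer {z})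
  have : Subsingleton (IsFreeGroup.Generators (Subgroup.centralizer {z})) := by
    by_contra h
    rw [not_subsingleton_iff_nontrivial] at h
    let z' : Subgroup.centralizer {z} := ⟨z, Subgroup.mem_centralizer_singleton_iff.2 rfl⟩
    have hz' : e z' = 1 := eq_one_of_forall_commute fun x => by
      have hx : Commute (e.symm (of x)) z' :=
        Subtype.ext (Subgroup.mem_centralizer_singleton_iff.1 (e.symm (of x)).2)
      simpa using hx.map e
    exact hz (congrArg Subtype.val (e.map_eq_one_iff.1 hz'))
  exact e.isCyclic.2 isCyclic_of_subsingleton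

theorem commute_of_commute {a b z : FreeGroup X} (hz : z ≠ 1) (ha : Commute a z)
    (hb : Commute b z) : Commute a b := by
  have := isCyclic_centralizer hz
  let _ := IsCyclic.commGroup (α := Subgroup.centralizer {z})
  exact congrArg Subtype.val (mul_comm (G := Subgroup.centralizer {z})
    ⟨a, Subgroup.mem_centralizer_singleton_iff.2 ha⟩
    ⟨b, Subgroup.mem_centralizer_singleton_iff.2 hb⟩)

theorem exists_zpow_eq_zpow {a z : FreeGroup X} (hz : z ≠ 1) (ha : Commute a z) :
    ∃ i j : ℤ, i ≠ 0 ∧ a ^ i = z ^ j := by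
  obtain ⟨⟨c, hc⟩, hgen⟩ := (isCyclic_centralizer hz).exists_generator
  obtain ⟨i, hi⟩ := hgen ⟨a, Subgroup.mem_centralizer_singleton_iff.2 ha⟩
  obtain ⟨j, hj⟩ := hgen ⟨z, Subgroup.mem_centralizer_singleton_iff.2 rfl⟩
  have hi' : c ^ i = a := congrArg Subtype.val hi
  have hj' : c ^ j = z := congrArg Subtype.val hj
  refine ⟨j, i, ?_, ?_⟩
  · rintro rfl
    exact hz (by simpa using hj'.symm)
  · rw [← hi', ← hj', ← zpow_mul, ← zpow_mul, mul_comm]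

theorem commute_of_conj_eq_or_eq_inv {w m : FreeGroup X}
    (h : w * m * w⁻¹ = m ∨ w * m * w⁻¹ = m⁻¹) : Commute w m := by
  rcases h with h | h
  · exact mul_inv_eq_iff_eq_mul.1 h
  · by_cases hw : w = 1
    · simp [hw]
    have hw2 : w ^ 2 ≠ 1 := by simpa using hw
    refine commute_of_commute hw2 (Commute.self_pow w 2) ?_
    have h2 : w ^ 2 * m * (w ^ 2)⁻¹ = m := by
      calc w ^ 2 * m * (w ^ 2)⁻¹ = w * (w * m * w⁻¹) * w⁻¹ := by simp only [pow_two]; group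
        _ = (w * m * w⁻¹)⁻¹ := by rw [conj_inv, h]
        _ = m := by rw [h, inv_inv]
    exact (mul_inv_eq_iff_eq_mul.1 h2).symm

open Classical in
/-- The set of letters occurring in the reduced word of an element of a free group. -/
def letters (m : FreeGroup X) : Set X := {x | ∃ b, (x, b) ∈ m.toWord}

theorem finite_letters (m : FreeGroup X) : m.letters.Finite := by
  classical
  refine (m.toWord.map Prod.fst).finite_toSet.subset ?_
  rintro x ⟨b, hb⟩
  exact List.mem_map_of_mem (f := Prod.fst) hb

theorem lift_eq_self {m : FreeGroup X} {f : X → FreeGroup X}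
    (hf : ∀ x ∈ m.letters, f x = of x) : lift f m = m := by
  classical
  conv_rhs => rw [← lift_of_apply m]
  conv_lhs => rw [← mk_toWord (x := m)]
  conv_rhs => rw [← mk_toWord (x := m)]
  rw [lift_mk, lift_mk]
  congr 1
  refine List.map_congr_left fun p hp => ?_
  rw [hf p.1 ⟨p.2, hp⟩]

theorem map_eq_self {m : FreeGroup X} {f : X → X} (hf : ∀ x ∈ m.letters, f x = x) :
    map f m = m := by
  rw [map_eq_lift]
  exact lift_eq_self fun x hx => by simp [hf x hx]

theorem letters_map_subset (f : X → X) (m : FreeGroup X) :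
    (map f m).letters ⊆ f '' m.letters := by
  classical
  rintro x ⟨b, hb⟩
  rw [← mk_toWord (x := m), map.mk, toWord_mk] at hb
  obtain ⟨p, hp, hpx⟩ := List.mem_map.1 (reduce.red.sublist.subset hb)
  simp only [Prod.mk.injEq] at hpx
  exact ⟨p.1, ⟨p.2, hp⟩, hpx.1⟩

theorem letters_inv (m : FreeGroup X) : m⁻¹.letters = m.letters := by
  classical
  ext x
  simp [letters, toWord_inv, invRev, or_comm]

open Classical in
/-- An element of a free group all of whose conjugates are at least as long. -/
def IsConjMinimal (m : FreeGroup X) : Prop := ∀ u : FreeGroup X, m.norm ≤ (u * m * u⁻¹).norm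

theorem exists_isConjMinimal (m : FreeGroup X) :
    ∃ u : FreeGroup X, (u * m * u⁻¹).IsConjMinimal := by
  classical
  obtain ⟨u, hu⟩ := WellFounded.has_min
    (InvImage.wf (fun u : FreeGroup X => (u * m * u⁻¹).norm) wellFounded_lt)
    Set.univ Set.univ_nonempty
  refine ⟨u, fun v => ?_⟩
  have h := not_lt.1 (hu.2 (v * u) (Set.mem_univ _))
  simpa [mul_assoc] using h

theorem IsConjMinimal.letters_subset {m : FreeGroup X} (hm : m.IsConjMinimal) (u : FreeGroup X) :
    m.letters ⊆ (u * m * u⁻¹).letters := by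
  classical
  set m' := u * m * u⁻¹ with hm'
  rintro x ⟨b, hb⟩
  by_contra hx
  let r : FreeGroup X →* FreeGroup X := lift fun y => if y ∈ m'.letters then of y else 1
  have hr : r m' = m' := lift_eq_self fun y hy => if_pos hy
  have hrm : r m = mk (m.toWord.filter fun p => p.1 ∈ m'.letters) := by
    conv_lhs => rw [← mk_toWord (x := m)]
    generalize m.toWord = L
    induction L with
    | nil => rfl
    | cons p L ih =>
      have hcons : ∀ L : List (X × Bool), mk (p :: L) = mk [p] * mk L := fun L => by
        rw [mul_mk]; rfl
      rw [hcons, _root_.map_mul, ih]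
      by_cases hp : p.1 ∈ m'.letters
      · rw [List.filter_cons_of_pos (by simpa using hp), hcons]
        rcases p with ⟨y, _ | _⟩ <;> simp_all [r, lift_mk, of, inv_mk, invRev]
      · rw [List.filter_cons_of_neg (by simpa using hp)]
        rcases p with ⟨y, _ | _⟩ <;> simp_all [r, lift_mk]
  have hlt : (r m).norm < m.norm := by
    rw [hrm]
    refine norm_mk_le.trans_lt (List.length_filter_lt_length_iff_exists.2 ⟨(x, b), hb, ?_⟩)
    simpa using hx
  have hle : m.norm ≤ (r m).norm := by
    have h := hm ((r u)⁻¹ * u)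
    have hconj : (r u)⁻¹ * u * m * ((r u)⁻¹ * u)⁻¹ = r m := by
      calc (r u)⁻¹ * u * m * ((r u)⁻¹ * u)⁻¹ = (r u)⁻¹ * m' * r u := by rw [hm']; group
        _ = (r u)⁻¹ * r m' * r u := by rw [hr]
        _ = r m := by rw [hm', _root_.map_mul, _root_.map_mul, _root_.map_inv]; group
    rwa [hconj] at h
  omega

end FreeGroup

/-- A subgroup is root-closed if it contains every element one of whose positive powers it
contains. -/
def Subgroup.IsRootClosed {G : Type*} [Group G] (D : Subgroup G) : Prop :=
  ∀ (g : G) (k : ℕ), k ≠ 0 → g ^ k ∈ D → g ∈ D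

/-- Every subgroup without free subgroups of rank two commutes with its normalizer. -/
def CentralizesNormalizers (G : Type*) [Group G] : Prop :=
  ∀ N : Subgroup G, HasNoFreeSubgroup N →
    ∀ n ∈ N, ∀ h ∈ Subgroup.normalizer (N : Set G), Commute n h

theorem CentralizesNormalizers.of_injective {G K : Type*} [Group G] [Group K]
    (hK : CentralizesNormalizers K) (f : G →* K) (hf : Function.Injective f) :
    CentralizesNormalizers G := by
  intro N hN n hn h hh
  have hcomm := hK (N.map f)
    (hN.of_surjective (f.subgroupMap N) (f.subgroupMap_surjective N)) (f n)
    (Subgroup.mem_map_of_mem f hn) (f h) (Subgroup.mem_normalizer_iff.2 fun x => ?_)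
  · exact hf (by simpa using hcomm.eq)
  · rw [Subgroup.mem_normalizer_iff] at hh
    constructor
    · rintro ⟨y, hy, rfl⟩
      exact ⟨h * y * h⁻¹, (hh y).1 hy, by simp⟩
    · rintro ⟨y, hy, hyx⟩
      refine ⟨h⁻¹ * y * h, (hh _).2 (by simpa [mul_assoc] using hy), ?_⟩
      rw [map_mul, map_mul, map_inv, hyx]
      group

section PermutationAction

variable (G X : Type*) [Group G] [MulAction G X]

/-- The action on a free group by automorphisms permuting the basis. -/
def basisPermutation : G →* MulAut (FreeGroup X) where
  toFun g := FreeGroup.freeGroupCongr (MulAction.toPerm g)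
  map_one' := by
    ext1 m
    exact FreeGroup.map_eq_self fun x _ => one_smul G x
  map_mul' g h := by
    ext1 m
    change FreeGroup.map _ m = FreeGroup.map _ (FreeGroup.map _ m)
    rw [FreeGroup.map.comp]
    congr 2
    funext x
    exact mul_smul g h x

/-- The stabilizers of the action are root-closed. -/
def HasRootClosedStabilizers : Prop :=
  ∀ x : X, (MulAction.stabilizer G x).IsRootClosed

variable {G X}

theorem basisPermutation_apply (g : G) (m : FreeGroup X) :
    basisPermutation G X g m = FreeGroup.map (g • ·) m := rfl

theorem smul_eq_of_subset_image (hX : HasRootClosedStabilizers G X) {g : G} {Y : Set X}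
    (hfin : Y.Finite) (hY : Y ⊆ (g • ·) '' Y) {x : X} (hx : x ∈ Y) : g • x = x := by
  have hmaps : Set.MapsTo (g⁻¹ • ·) Y Y := by
    intro y hy
    obtain ⟨z, hz, rfl⟩ := hY hy
    simpa using hz
  have := hfin.to_subtype
  obtain ⟨k, hk, hper⟩ := Function.mem_periodicPts.1 (Function.Injective.mem_periodicPts
    (hmaps.restrict_inj.2 (MulAction.injective g⁻¹).injOn) ⟨x, hx⟩)
  have hiter : (g⁻¹) ^ k • x = x := by
    have hsemi : Function.Semiconj Subtype.val (hmaps.restrict _ _ _) (g⁻¹ • · : X → X) :=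
      fun _ => rfl
    have h := (hsemi.iterate_right k).eq ⟨x, hx⟩
    rw [hper.eq, smul_iterate] at h
    exact h.symm
  have h : g⁻¹ • x = x := hX x g⁻¹ k hk.ne' hiter
  exact (inv_smul_eq_iff.1 h).symm

theorem basisPermutation_eq_self_of_letters_subset (hX : HasRootClosedStabilizers G X) {g : G}
    {m m' : FreeGroup X} (hm : m.letters ⊆ (basisPermutation G X g m).letters)
    (hm' : m'.letters ⊆ m.letters) : basisPermutation G X g m' = m' :=
  FreeGroup.map_eq_self fun _ hx => smul_eq_of_subset_image hX m.finite_letters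
    (hm.trans (FreeGroup.letters_map_subset _ m)) (hm' hx)

theorem basisPermutation_eq_self_of_pow (hX : HasRootClosedStabilizers G X) {g : G}
    {m : FreeGroup X} {k : ℕ} (hk : k ≠ 0) (hm : basisPermutation G X (g ^ k) m = m) :
    basisPermutation G X g m = m := by
  refine FreeGroup.map_eq_self fun x hx => hX x g k hk ?_
  exact smul_eq_of_subset_image hX m.finite_letters
    ((congrArg FreeGroup.letters hm).symm.subset.trans (FreeGroup.letters_map_subset _ m)) hx

open SemidirectProduct
open scoped commutatorElement

theorem isRootClosed_map_inr (hX : HasRootClosedStabilizers G X) {D : Subgroup G}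
    (hD : D.IsRootClosed) :
    (D.map (inr : G →* FreeGroup X ⋊[basisPermutation G X] G)).IsRootClosed := by
  rintro a k hk ⟨d, hd, hda⟩
  obtain rfl : d = a.right ^ k := by
    have h := congrArg rightHom hda
    rwa [rightHom_inr, map_pow] at h
  have hleft : basisPermutation G X (a.right ^ k) a.left = a.left := by
    have h : a * a ^ k = a ^ k * a := (Commute.self_pow a k).eq
    rw [← hda] at h
    simpa only [mul_left, left_inr, right_inr, one_mul, map_one, mul_one] using
      (congrArg SemidirectProduct.left h).symm
  have hfix := basisPermutation_eq_self_of_pow hX hk hleft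
  have hcomm : Commute (inl a.left : FreeGroup X ⋊[basisPermutation G X] G) (inr a.right) := by
    ext <;> simp [hfix]
  have hone : a.left = 1 := by
    have h : (inl a.left * inr a.right : FreeGroup X ⋊[basisPermutation G X] G) ^ k = a ^ k := by
      rw [inl_left_mul_inr_right]
    rw [hcomm.mul_pow, ← hda, map_pow, mul_eq_right, ← map_pow] at h
    have h' : a.left ^ k = 1 := inl_injective (h.trans (map_one _).symm)
    exact (pow_eq_one_iff_left hk).1 h'
  refine ⟨a.right, hD _ k hk hd, ?_⟩
  rw [← inl_left_mul_inr_right a, hone]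
  simp

theorem conj_inl_eq_inl (a : FreeGroup X ⋊[basisPermutation G X] G) (m : FreeGroup X) :
    a * inl m * a⁻¹ = inl (a.left * basisPermutation G X a.right m * a.left⁻¹) := by
  conv_lhs => rw [← inl_left_mul_inr_right a]
  rw [map_mul, map_mul, inl_aut, map_inv, map_inv]
  group

theorem IsConjMinimal.fixed (hX : HasRootClosedStabilizers G X) {m : FreeGroup X}
    (hm : m.IsConjMinimal) {a : FreeGroup X ⋊[basisPermutation G X] G}
    (ha : a * inl m * a⁻¹ = inl m ∨ a * inl m * a⁻¹ = inl m⁻¹) :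
    Commute a.left m ∧
      ∀ m' : FreeGroup X, m'.letters ⊆ m.letters → basisPermutation G X a.right m' = m' := by
  rw [conj_inl_eq_inl, inl_inj, inl_inj] at ha
  have hsub : m.letters ⊆ (basisPermutation G X a.right m).letters := by
    rcases ha with h | h
    · have h' : a.left⁻¹ * m * a.left⁻¹⁻¹ = basisPermutation G X a.right m := by
        generalize basisPermutation G X a.right m = m' at h
        rw [← h]
        group
      rw [← h']
      exact hm.letters_subset _
    · have h' : a.left⁻¹ * m * a.left⁻¹⁻¹ = (basisPermutation G X a.right m)⁻¹ := by
        generalize basisPermutation G X a.right m = m' at h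
        rw [← inv_inv m, ← h]
        group
      rw [← FreeGroup.letters_inv (basisPermutation G X a.right m), ← h']
      exact hm.letters_subset _
  have hfix : ∀ m' : FreeGroup X, m'.letters ⊆ m.letters → basisPermutation G X a.right m' = m' :=
    fun _ => basisPermutation_eq_self_of_letters_subset hX hsub
  refine ⟨FreeGroup.commute_of_conj_eq_or_eq_inv ?_, hfix⟩
  rwa [hfix m subset_rfl] at ha

theorem basisPermutation_eq_self_of_commute {g : G} {m w : FreeGroup X} (hm : m ≠ 1)
    (hg : basisPermutation G X g m = m) (hw : Commute w m) : basisPermutation G X g w = w := by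
  obtain ⟨i, j, hi, hij⟩ := FreeGroup.exists_zpow_eq_zpow hm hw
  refine zpow_left_injective hi ?_
  change basisPermutation G X g w ^ i = w ^ i
  rw [← map_zpow, hij, map_zpow, hg]

theorem commute_of_isConjMinimal (hX : HasRootClosedStabilizers G X) {m : FreeGroup X}
    (hm : m.IsConjMinimal) (hm1 : m ≠ 1) {a b : FreeGroup X ⋊[basisPermutation G X] G}
    (ha : a * inl m * a⁻¹ = inl m ∨ a * inl m * a⁻¹ = inl m⁻¹)
    (hb : b * inl m * b⁻¹ = inl m ∨ b * inl m * b⁻¹ = inl m⁻¹)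
    (hab : Commute a.right b.right) : Commute a b := by
  obtain ⟨ha, hfa⟩ := IsConjMinimal.fixed hX hm ha
  obtain ⟨hb, hfb⟩ := IsConjMinimal.fixed hX hm hb
  have hba := basisPermutation_eq_self_of_commute hm1 (hfa m subset_rfl) hb
  have hab' := basisPermutation_eq_self_of_commute hm1 (hfb m subset_rfl) ha
  refine SemidirectProduct.ext ?_ hab.eq
  rw [mul_left, mul_left, hba, hab']
  exact (FreeGroup.commute_of_commute hm1 ha hb).eq

theorem commute_of_conj_inl_eq (hX : HasRootClosedStabilizers G X) {m : FreeGroup X}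
    (hm : m ≠ 1) {a b : FreeGroup X ⋊[basisPermutation G X] G}
    (ha : a * inl m * a⁻¹ = inl m ∨ a * inl m * a⁻¹ = inl m⁻¹)
    (hb : b * inl m * b⁻¹ = inl m ∨ b * inl m * b⁻¹ = inl m⁻¹)
    (hab : Commute a.right b.right) : Commute a b := by
  obtain ⟨u, hu⟩ := FreeGroup.exists_isConjMinimal m
  let c : MulAut (FreeGroup X ⋊[basisPermutation G X] G) := MulAut.conj (inl u)
  have hc : ∀ m : FreeGroup X, c (inl m) = inl (u * m * u⁻¹) := fun m => by
    simp [c, MulAut.conj_apply]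
  have key : ∀ x : FreeGroup X ⋊[basisPermutation G X] G,
      x * inl m * x⁻¹ = inl m ∨ x * inl m * x⁻¹ = inl m⁻¹ →
      c x * inl (u * m * u⁻¹) * (c x)⁻¹ = inl (u * m * u⁻¹) ∨
      c x * inl (u * m * u⁻¹) * (c x)⁻¹ = inl (u * m * u⁻¹)⁻¹ := by
    intro x hx
    rw [conj_inv, ← hc, ← hc, ← map_inv, ← map_mul, ← map_mul]
    exact hx.imp (congrArg c) (congrArg c)
  have hright : ∀ x, (c x).right = x.right := fun x => by simp [c, MulAut.conj_apply]
  have h := commute_of_isConjMinimal hX hu (by simpa using hm) (key a ha) (key b hb)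
    (by rwa [hright, hright])
  exact c.injective (by simpa using h.eq)

theorem conj_eq_or_eq_inv_of_normalizes_zpowers {K : Type*} [Group K] {h m : K}
    (hm : ∀ k : ℤ, m ^ k = 1 → k = 0)
    (hh : h ∈ Subgroup.normalizer (Subgroup.zpowers m : Set K)) :
    h * m * h⁻¹ = m ∨ h * m * h⁻¹ = m⁻¹ := by
  obtain ⟨i, hi⟩ := (Subgroup.mem_normalizer_iff.1 hh m).1 (Subgroup.mem_zpowers m)
  obtain ⟨j, hj⟩ := (Subgroup.mem_normalizer_iff.1 (inv_mem hh) m).1 (Subgroup.mem_zpowers m)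
  simp only [inv_inv] at hi hj
  have hij : m ^ (i * j - 1) = 1 := by
    have h1 : h * (m ^ j) * h⁻¹ = m := by rw [hj]; group
    rw [← conj_zpow, ← hi, ← zpow_mul] at h1
    rw [zpow_sub, h1]; simp
  have hij' : i * j = 1 := by have := hm _ hij; omega
  rcases Int.eq_one_or_neg_one_of_mul_eq_one hij' with rfl | rfl
  · exact Or.inl (by simpa using hi.symm)
  · exact Or.inr (by simpa using hi.symm)

theorem CentralizesNormalizers.semidirectProduct (hX : HasRootClosedStabilizers G X)
    (hG : CentralizesNormalizers G) :
    CentralizesNormalizers (FreeGroup X ⋊[basisPermutation G X] G) := by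
  intro N hN n hn h hh
  have hright : Commute n.right h.right := by
    refine hG (N.map rightHom) (hN.of_surjective (rightHom.subgroupMap N)
      (rightHom.subgroupMap_surjective N)) _ (Subgroup.mem_map_of_mem rightHom hn) _ ?_
    exact Subgroup.le_normalizer_map rightHom (Subgroup.mem_map_of_mem rightHom hh)
  let M : Subgroup (FreeGroup X) := N.comap inl
  have hMfree : HasNoFreeSubgroup M := hN.of_injective (inl.subgroupComap N) fun x y hxy =>
    Subtype.ext (inl_injective (congrArg Subtype.val hxy))
  have hker : M.map inl = N ⊓ (rightHom : FreeGroup X ⋊[basisPermutation G X] G →* G).ker := by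
    rw [← range_inl_eq_ker_rightHom, Subgroup.map_comap_eq, inf_comm]
  have hMconj : ∀ a ∈ Subgroup.normalizer (N : Set (FreeGroup X ⋊[basisPermutation G X] G)),
      a ∈ Subgroup.normalizer ((M.map inl : Subgroup (FreeGroup X ⋊[basisPermutation G X] G)) :
        Set (FreeGroup X ⋊[basisPermutation G X] G)) := by
    intro a ha
    rw [Subgroup.mem_normalizer_iff] at ha ⊢
    intro x
    rw [hker, Subgroup.mem_inf, Subgroup.mem_inf, ← ha x, MonoidHom.normal_ker _ |>.mem_comm_iff]
    simp
  obtain ⟨⟨m, hmM⟩, hgen⟩ := (FreeGroup.isCyclic_of_hasNoFreeSubgroup hMfree).exists_generator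
  have hM : M.map inl =
      Subgroup.zpowers (inl m : FreeGroup X ⋊[basisPermutation G X] G) := by
    rw [← MonoidHom.map_zpowers]
    congr 1
    refine le_antisymm (fun x hx => ?_) (by simpa using hmM)
    obtain ⟨k, hk⟩ := hgen ⟨x, hx⟩
    exact ⟨k, congrArg Subtype.val hk⟩
  rw [hM] at hMconj
  by_cases hm : m = 1
  · have hcomm : ⁅n, h⁆ ∈ M.map inl := by
      rw [hker, Subgroup.mem_inf]
      refine ⟨?_, ?_⟩
      · rw [commutatorElement_def, mul_assoc, mul_assoc, ← mul_assoc h]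
        exact mul_mem hn ((Subgroup.mem_normalizer_iff.1 hh _).1 (inv_mem hn))
      · rw [MonoidHom.mem_ker, map_commutatorElement,
          commutatorElement_eq_one_iff_commute]
        exact hright
    rw [hM, hm] at hcomm
    simpa [commutatorElement_eq_one_iff_commute] using hcomm
  · have key : ∀ a ∈ Subgroup.normalizer (N : Set (FreeGroup X ⋊[basisPermutation G X] G)),
        a * inl m * a⁻¹ = inl m ∨ a * inl m * a⁻¹ = inl m⁻¹ := by
      intro a ha
      rw [map_inv]
      refine conj_eq_or_eq_inv_of_normalizes_zpowers (fun k hk => ?_) (hMconj a ha)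
      rw [← map_zpow] at hk
      by_contra hk0
      refine hm (zpow_left_injective hk0 ?_)
      simpa using inl_injective (hk.trans (map_one _).symm)
    exact commute_of_conj_inl_eq hX hm (key n (Subgroup.le_normalizer hn)) (key h hh) hright

end PermutationAction

theorem hasRootClosedStabilizers_quotient {G : Type*} [Group G] {L : Subgroup G}
    (hL : L.IsRootClosed) : HasRootClosedStabilizers G (G ⧸ L) := by
  intro x g k hk hg
  induction x using QuotientGroup.induction_on with
  | H a =>
    have hiff : ∀ g : G, g ∈ MulAction.stabilizer G (a : G ⧸ L) ↔ a⁻¹ * g * a ∈ L := by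
      intro g
      rw [MulAction.mem_stabilizer_iff, eq_comm, mul_assoc]
      exact QuotientGroup.eq
    rw [hiff] at hg ⊢
    refine hL _ k hk ?_
    have h := conj_pow (i := k) (a := a⁻¹) (b := g)
    rw [inv_inv] at h
    rwa [h]

namespace RAAG

open scoped commutatorElement

variable {V : Type*} (Γ : SimpleGraph V)

theorem commute_of_adj {Γ : SimpleGraph V} {u v : V} (h : Γ.Adj u v) :
    Commute (PresentedGroup.of u : RAAG Γ) (PresentedGroup.of v) := by
  have h1 := PresentedGroup.one_of_mem (rels := raagRels Γ) ⟨u, v, h, rfl⟩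
  simp only [map_mul, map_inv] at h1
  exact commutatorElement_eq_one_iff_commute.1 h1

/-- The homomorphism from a right-angled Artin group given by images of the generators. -/
def lift {Γ : SimpleGraph V} {G : Type*} [Group G] (f : V → G)
    (hf : ∀ u v, Γ.Adj u v → Commute (f u) (f v)) : RAAG Γ →* G :=
  PresentedGroup.toGroup (f := f) <| by
    rintro _ ⟨u, v, huv, rfl⟩
    simpa [← commutatorElement_def] using commutatorElement_eq_one_iff_commute.2 (hf u v huv)

@[simp]
theorem lift_of {Γ : SimpleGraph V} {G : Type*} [Group G] (f : V → G)
    (hf : ∀ u v, Γ.Adj u v → Commute (f u) (f v)) (v : V) :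
    lift f hf (PresentedGroup.of v) = f v :=
  PresentedGroup.toGroup.of _

/-- The subgroup generated by a set of vertices. -/
def parabolic (S : Set V) : Subgroup (RAAG Γ) := Subgroup.closure (PresentedGroup.of '' S)

theorem parabolic_univ : parabolic Γ Set.univ = ⊤ := by
  rw [parabolic, Set.image_univ, PresentedGroup.closure_range_of]

theorem parabolic_mono {S T : Set V} (h : S ⊆ T) : parabolic Γ S ≤ parabolic Γ T :=
  Subgroup.closure_mono (Set.image_mono h)

/-- The homomorphism between right-angled Artin groups induced by the inclusion of an induced
subgraph. -/
def incl (S : Set V) : RAAG (Γ.induce S) →* RAAG Γ :=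
  lift (fun u => PresentedGroup.of u.1) fun _ _ h => commute_of_adj h

@[simp]
theorem incl_of (S : Set V) (u : S) :
    incl Γ S (PresentedGroup.of u) = PresentedGroup.of u.1 := lift_of ..

open Classical in
/-- The retraction onto the right-angled Artin group of an induced subgraph which kills the
remaining generators. -/
noncomputable def retraction (S : Set V) : RAAG Γ →* RAAG (Γ.induce S) :=
  lift (fun u => if h : u ∈ S then PresentedGroup.of ⟨u, h⟩ else 1) fun u v h => by
    by_cases hu : u ∈ S <;> by_cases hv : v ∈ S <;> simp only [hu, hv, dif_pos, dif_neg,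
      not_false_eq_true, Commute.one_left, Commute.one_right]
    exact commute_of_adj (Γ := Γ.induce S) h

theorem incl_injective (S : Set V) : Function.Injective (incl Γ S) := by
  have h : (retraction Γ S).comp (incl Γ S) = MonoidHom.id _ :=
    PresentedGroup.ext fun u => by simp [retraction]
  exact Function.LeftInverse.injective (g := retraction Γ S) fun x => DFunLike.congr_fun h x

theorem map_incl_parabolic (S : Set V) (T : Set S) :
    (parabolic (Γ.induce S) T).map (incl Γ S) = parabolic Γ (Subtype.val '' T) := by
  rw [parabolic, parabolic, MonoidHom.map_closure, Set.image_image, Set.image_image]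
  simp only [incl_of]

theorem range_incl (S : Set V) : (incl Γ S).range = parabolic Γ S := by
  rw [MonoidHom.range_eq_map, ← parabolic_univ, map_incl_parabolic, Set.image_univ,
    Subtype.range_coe]

theorem exists_finite_mem_parabolic (g : RAAG Γ) :
    ∃ S : Set V, S.Finite ∧ g ∈ parabolic Γ S := by
  have hg : g ∈ parabolic Γ Set.univ := by simp [parabolic_univ]
  induction hg using Subgroup.closure_induction with
  | mem x hx =>
    obtain ⟨v, -, rfl⟩ := hx
    exact ⟨{v}, Set.finite_singleton v, Subgroup.subset_closure ⟨v, rfl, rfl⟩⟩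
  | one => exact ⟨∅, Set.finite_empty, one_mem _⟩
  | mul x y _ _ hx hy =>
    obtain ⟨S, hS, hxS⟩ := hx
    obtain ⟨T, hT, hyT⟩ := hy
    exact ⟨S ∪ T, hS.union hT, mul_mem (parabolic_mono Γ Set.subset_union_left hxS)
      (parabolic_mono Γ Set.subset_union_right hyT)⟩
  | inv x _ hx =>
    obtain ⟨S, hS, hxS⟩ := hx
    exact ⟨S, hS, inv_mem hxS⟩

section VertexRemoval

open SemidirectProduct

variable (v : V)

/-- The link of `v`, as a set of vertices of the graph with `v` removed. -/
def link : Set ({v}ᶜ : Set V) := {u | Γ.Adj u v}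

/-- The cosets of the link subgroup of `v` in the right-angled Artin group on the graph with `v`
removed. They index a basis of the kernel of the retraction killing `v`. -/
abbrev LinkCosets : Type _ :=
  RAAG (Γ.induce ({v}ᶜ : Set V)) ⧸ parabolic (Γ.induce ({v}ᶜ : Set V)) (link Γ v)

/-- The semidirect product decomposition of a right-angled Artin group associated to the
retraction killing `v`. -/
abbrev VertexSplitting : Type _ :=
  FreeGroup (LinkCosets Γ v) ⋊[basisPermutation (RAAG (Γ.induce ({v}ᶜ : Set V))) (LinkCosets Γ v)]
    RAAG (Γ.induce ({v}ᶜ : Set V))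

open Classical in
/-- The homomorphism to the splitting sending `v` to the basis element given by the trivial
coset. -/
noncomputable def toSplitting : RAAG Γ →* VertexSplitting Γ v :=
  lift (fun u => if h : u = v then inl (FreeGroup.of ((1 : RAAG (Γ.induce ({v}ᶜ : Set V))) :
      LinkCosets Γ v)) else inr (PresentedGroup.of ⟨u, h⟩)) <| by
    have hlink : ∀ (u : V) (hu : u ≠ v), Γ.Adj u v →
        Commute (inr (PresentedGroup.of ⟨u, hu⟩) : VertexSplitting Γ v)
          (inl (FreeGroup.of ((1 : RAAG (Γ.induce ({v}ᶜ : Set V))) : LinkCosets Γ v))) := by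
      intro u hu h
      have hfix : (PresentedGroup.of ⟨u, hu⟩ : RAAG (Γ.induce ({v}ᶜ : Set V))) •
          ((1 : RAAG (Γ.induce ({v}ᶜ : Set V))) : LinkCosets Γ v) =
          ((1 : RAAG (Γ.induce ({v}ᶜ : Set V))) : LinkCosets Γ v) := by
        refine (QuotientGroup.eq.2 ?_).symm
        simp only [inv_one, one_mul, smul_eq_mul, mul_one]
        exact Subgroup.subset_closure ⟨⟨u, hu⟩, h, rfl⟩
      refine SemidirectProduct.ext ?_ ?_ <;> simp [basisPermutation_apply, hfix]
    intro u w h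
    by_cases hu : u = v <;> by_cases hw : w = v
    · exact absurd (hu.trans hw.symm) h.ne
    · subst hu
      simpa [hw] using (hlink w hw h.symm).symm
    · subst hw
      simpa [hu] using hlink u hu h
    · simp only [hu, hw, dif_neg, not_false_eq_true]
      exact (commute_of_adj (Γ := Γ.induce ({v}ᶜ : Set V)) (u := ⟨u, hu⟩) (v := ⟨w, hw⟩) h).map inr

theorem toSplitting_of_ne (u : ({v}ᶜ : Set V)) :
    toSplitting Γ v (PresentedGroup.of u.1) = inr (PresentedGroup.of u) := by
  simp [toSplitting, show u.1 ≠ v from u.2]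

theorem toSplitting_of_self :
    toSplitting Γ v (PresentedGroup.of v) =
      inl (FreeGroup.of ((1 : RAAG (Γ.induce ({v}ᶜ : Set V))) : LinkCosets Γ v)) := by
  simp [toSplitting]

theorem commute_incl_of_mem_link {g : RAAG (Γ.induce ({v}ᶜ : Set V))}
    (hg : g ∈ parabolic (Γ.induce ({v}ᶜ : Set V)) (link Γ v)) :
    Commute (incl Γ _ g) (PresentedGroup.of v) := by
  have hle : parabolic (Γ.induce ({v}ᶜ : Set V)) (link Γ v) ≤
      (Subgroup.centralizer {PresentedGroup.of v}).comap (incl Γ _) := by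
    refine (Subgroup.closure_le _).2 ?_
    rintro _ ⟨u, hu, rfl⟩
    rw [SetLike.mem_coe, Subgroup.mem_comap, Subgroup.mem_centralizer_singleton_iff, incl_of]
    exact commute_of_adj hu
  exact Subgroup.mem_centralizer_singleton_iff.1 (hle hg)

/-- The conjugate of the generator `v` by any representative of a coset of its link subgroup. -/
def vertexConjugate : LinkCosets Γ v → RAAG Γ :=
  Quotient.lift (fun g => incl Γ _ g * PresentedGroup.of v * (incl Γ _ g)⁻¹) <| by
    intro a b hab
    have h := (commute_incl_of_mem_link Γ v (QuotientGroup.leftRel_apply.1 hab)).eq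
    rw [map_mul, map_inv] at h
    calc incl Γ _ a * PresentedGroup.of v * (incl Γ _ a)⁻¹
        = incl Γ _ a * (PresentedGroup.of v * ((incl Γ _ a)⁻¹ * incl Γ _ b)) * (incl Γ _ b)⁻¹ := by
          group
      _ = incl Γ _ b * PresentedGroup.of v * (incl Γ _ b)⁻¹ := by
          rw [← h]
          group

/-- The homomorphism from the splitting sending a coset to the conjugate of `v`. -/
def ofSplitting : VertexSplitting Γ v →* RAAG Γ :=
  SemidirectProduct.lift (FreeGroup.lift (vertexConjugate Γ v)) (incl Γ _) fun g => by
    ext x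
    induction x using QuotientGroup.induction_on with
    | H a =>
      simp only [MonoidHom.comp_apply, MulEquiv.coe_toMonoidHom, basisPermutation_apply,
        FreeGroup.map.of, FreeGroup.lift_apply_of, MulAut.conj_apply]
      change incl Γ _ (g * a) * _ * (incl Γ _ (g * a))⁻¹ =
        _ * (incl Γ _ a * _ * (incl Γ _ a)⁻¹) * _
      rw [map_mul]
      group

theorem ofSplitting_inr (g : RAAG (Γ.induce ({v}ᶜ : Set V))) :
    ofSplitting Γ v (inr g) = incl Γ _ g := lift_inr ..

theorem ofSplitting_toSplitting (g : RAAG Γ) : ofSplitting Γ v (toSplitting Γ v g) = g := by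
  have h : (ofSplitting Γ v).comp (toSplitting Γ v) = MonoidHom.id _ := by
    refine PresentedGroup.ext fun u => ?_
    by_cases hu : u = v
    · subst hu
      rw [MonoidHom.comp_apply, toSplitting_of_self, ofSplitting, lift_inl, FreeGroup.lift_apply_of]
      change incl Γ _ 1 * _ * (incl Γ _ 1)⁻¹ = _
      simp
    · rw [MonoidHom.comp_apply, toSplitting_of_ne Γ v ⟨u, hu⟩, ofSplitting_inr, incl_of]
      rfl
  exact DFunLike.congr_fun h g

theorem toSplitting_injective : Function.Injective (toSplitting Γ v) :=
  Function.LeftInverse.injective (ofSplitting_toSplitting Γ v)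

end VertexRemoval

theorem card_compl_singleton_lt [Finite V] (v : V) : Nat.card ({v}ᶜ : Set V) < Nat.card V :=
  Finite.card_subtype_lt (p := (· ∈ ({v}ᶜ : Set V))) (x := v) (by simp)

theorem isRootClosed_parabolic [Finite V] (S : Set V) : (parabolic Γ S).IsRootClosed := by
  induction hn : Nat.card V using Nat.strong_induction_on generalizing V with
  | h n ih =>
    by_cases hS : S = Set.univ
    · intro g k _ _
      simp [hS, parabolic_univ]
    obtain ⟨v, hv⟩ := (Set.ne_univ_iff_exists_notMem S).1 hS
    have ih' := fun T => ih _ (hn ▸ card_compl_singleton_lt v) (Γ.induce ({v}ᶜ : Set V)) T rfl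
    have hS' : Subtype.val '' ((Subtype.val : ({v}ᶜ : Set V) → V) ⁻¹' S) = S := by
      rw [Subtype.image_preimage_coe, Set.inter_eq_right]
      rintro x hx rfl
      exact hv hx
    have hmap : parabolic Γ S = ((parabolic (Γ.induce ({v}ᶜ : Set V)) (Subtype.val ⁻¹' S)).map
        SemidirectProduct.inr).comap (toSplitting Γ v) := by
      apply le_antisymm
      · refine (Subgroup.closure_le _).2 ?_
        rintro _ ⟨u, hu, rfl⟩
        have huv : u ∈ ({v}ᶜ : Set V) := fun h => hv (h ▸ hu)
        exact ⟨_, Subgroup.subset_closure ⟨⟨u, huv⟩, hu, rfl⟩,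
          (toSplitting_of_ne Γ v ⟨u, huv⟩).symm⟩
      · rintro g ⟨d, hd, hdg⟩
        rw [← ofSplitting_toSplitting Γ v g, ← hdg, ofSplitting_inr, ← hS', ← map_incl_parabolic]
        exact Subgroup.mem_map_of_mem _ hd
    intro g k hk hg
    rw [hmap, Subgroup.mem_comap] at hg ⊢
    rw [map_pow] at hg
    exact isRootClosed_map_inr (hasRootClosedStabilizers_quotient (ih' _)) (ih' _) _ k hk hg

theorem centralizesNormalizers_of_finite [Finite V] : CentralizesNormalizers (RAAG Γ) := by
  induction hn : Nat.card V using Nat.strong_induction_on generalizing V with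
  | h n ih =>
    rcases isEmpty_or_nonempty V with hV | ⟨⟨v⟩⟩
    · intro N _ x _ y _
      have : Subsingleton (RAAG Γ) := (PresentedGroup.mk_surjective (raagRels Γ)).subsingleton
      exact Subsingleton.elim _ _
    · have hX := hasRootClosedStabilizers_quotient
        (isRootClosed_parabolic (Γ.induce ({v}ᶜ : Set V)) (link Γ v))
      exact ((ih _ (hn ▸ card_compl_singleton_lt v) _ rfl).semidirectProduct hX).of_injective _
        (toSplitting_injective Γ v)

theorem centralizesNormalizers : CentralizesNormalizers (RAAG Γ) := by
  intro N hN n hn h hh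
  obtain ⟨S, hS, hnS⟩ := exists_finite_mem_parabolic Γ n
  obtain ⟨T, hT, hhT⟩ := exists_finite_mem_parabolic Γ h
  have := (hS.union hT).to_subtype
  have hnr := parabolic_mono Γ (Set.subset_union_left (t := T)) hnS
  have hhr := parabolic_mono Γ (Set.subset_union_right (s := S)) hhT
  rw [← range_incl] at hnr hhr
  obtain ⟨n, rfl⟩ := hnr
  obtain ⟨h, rfl⟩ := hhr
  have hcomm := centralizesNormalizers_of_finite (Γ.induce (S ∪ T)) (N.comap (incl Γ (S ∪ T)))
    (hN.of_injective ((incl Γ (S ∪ T)).subgroupComap N) fun x y hxy =>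
      Subtype.ext (incl_injective Γ _ (congrArg Subtype.val hxy))) n hn h ?_
  · exact hcomm.map _
  · rw [Subgroup.mem_normalizer_iff] at hh ⊢
    intro x
    simpa using hh (incl Γ (S ∪ T) x)

end RAAG

/-- A normal subgroup of a subgroup of a right-angled Artin group containing no
non-abelian free subgroup is central. -/
theorem normal_subgroup_no_free_is_central
    {V : Type*} (Γ : SimpleGraph V) (H : Subgroup (RAAG Γ))
    (N : Subgroup H) [N.Normal]
    (hfree : ¬ ∃ f : FreeGroup (Fin 2) →* N, Function.Injective f) :
    N ≤ Subgroup.center H := by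
  have hH := (RAAG.centralizesNormalizers Γ).of_injective H.subtype H.subtype_injective
  intro n hn
  refine Subgroup.mem_center_iff.2 fun h => ?_
  have hh : h ∈ Subgroup.normalizer (N : Set H) := by simp [Subgroup.normalizer_eq_top]
  exact (hH N hfree n hn h hh).symm.eq
end
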